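/- Let G be a graph on n ≥ 1 vertices with Laplacian matrix L(G), let p ≥ 1, and let H = K_{1,p−1} ∘_1 (G ∨ K_1) with Laplacian matrix L and identified vertex u*. Then L(G) + I_n is invertible, and for every matrix X with L·X·L = L, the quantity r(i,j) = X_{ii} + X_{jj} − X_{ij} − X_{ji} satisfies: (i) r(u*, j) = 1 for each leaf j; (ii) r(u*, j) = ((L(G)+I_n)⁻¹)_{jj} for j ∈ V(G); (iii) r(i,j) = 2 for distinct leaves i, j; (iv) r(i,j) = 1 + ((L(G)+I_n)⁻¹)_{jj} for a leaf i and j ∈ V(G); (v) r(i,j) = ((L(G)+I_n)⁻¹)_{ii} + ((L(G)+I_n)⁻¹)_{jj} − 2((L(G)+I_n)⁻¹)_{ij} for distinct i, j ∈ V(G). -/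

import Mathlib

open Matrix

-- The Laplacian matrix `L = D − A` of a finite simple graph, over `ℝ`.
open Classical in
noncomputable def lapMat {V : Type} [Fintype V] (G : SimpleGraph V) : Matrix V V ℝ :=
  Matrix.of fun i j =>
    if i = j then (Nat.card {v // G.Adj i v} : ℝ)
    else if G.Adj i j then -1 else 0

/-- Vertex set of `K_{1,p−1} ∘₁ (G ∨ K₁)`: the identified vertex `u*`, the `s = p − 1`
leaves of the star, and the vertices of `G`. -/
abbrev SCV (s n : ℕ) := Unit ⊕ (Fin s ⊕ Fin n)

/-- The graph `K_{1,p−1} ∘₁ (G ∨ K₁)` (with `s = p − 1`): each leaf is adjacent only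
to `u*`, `u*` is adjacent to every vertex of `G`, and the edges inside `V(G)` are the
edges of `G`. -/
def StarJoinCoal (s : ℕ) {n : ℕ} (G : SimpleGraph (Fin n)) : SimpleGraph (SCV s n) :=
  SimpleGraph.fromRel (fun u v =>
    match u, v with
    | Sum.inl _, Sum.inr _ => True
    | Sum.inr _, Sum.inl _ => True
    | Sum.inr (Sum.inr x), Sum.inr (Sum.inr y) => G.Adj x y
    | _, _ => False)

lemma lapMat_eq_lapMatrix {V : Type} [Fintype V] [DecidableEq V] (G : SimpleGraph V)
    [DecidableRel G.Adj] : lapMat G = G.lapMatrix ℝ := by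
  ext i j
  by_cases h : i = j
  · subst h
    simp [lapMat, SimpleGraph.lapMatrix, SimpleGraph.degMatrix, Nat.card_eq_fintype_card,
      ← SimpleGraph.card_neighborSet_eq_degree, SimpleGraph.neighborSet]
    rfl
  · by_cases h' : G.Adj i j <;>
      simp [lapMat, SimpleGraph.lapMatrix, SimpleGraph.degMatrix, h, h']

lemma lapMat_isSymm {V : Type} [Fintype V] (G : SimpleGraph V) : (lapMat G).IsSymm := by
  classical
  rw [lapMat_eq_lapMatrix]
  exact G.isSymm_lapMatrix (R := ℝ)

open Classical in
lemma lapMat_mulVec_apply {V : Type} [Fintype V] (G : SimpleGraph V) (w : V → ℝ) (i : V) :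
    (lapMat G *ᵥ w) i = ∑ j, if G.Adj i j then w i - w j else 0 := by
  rw [lapMat_eq_lapMatrix, SimpleGraph.lapMatrix_mulVec_apply, ← Finset.sum_filter,
    Finset.sum_sub_distrib, Finset.sum_const, nsmul_eq_mul, ← SimpleGraph.neighborFinset_eq_filter,
    SimpleGraph.card_neighborFinset_eq_degree]

lemma sum_lapMat_mulVec {V : Type} [Fintype V] (G : SimpleGraph V) (w : V → ℝ) :
    ∑ i, (lapMat G *ᵥ w) i = 0 := by
  classical
  have h : lapMat G *ᵥ (fun _ => 1) = 0 := by
    ext i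
    simp [lapMat_mulVec_apply]
  calc ∑ i, (lapMat G *ᵥ w) i = (fun _ => 1) ⬝ᵥ (lapMat G *ᵥ w) := by simp [dotProduct]
    _ = 0 := by
      rw [dotProduct_mulVec, ← mulVec_transpose, (lapMat_isSymm G).eq, h, zero_dotProduct]

lemma isUnit_lapMat_add_one {V : Type} [Fintype V] [DecidableEq V] (G : SimpleGraph V) :
    IsUnit (lapMat G + (1 : Matrix V V ℝ)) := by
  classical
  rw [lapMat_eq_lapMatrix]
  exact (PosDef.posSemidef_add (G.posSemidef_lapMatrix ℝ) PosDef.one).isUnit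

lemma inv_lapMat_add_one_isSymm {V : Type} [Fintype V] [DecidableEq V] (G : SimpleGraph V) :
    ((lapMat G + (1 : Matrix V V ℝ))⁻¹).IsSymm := by
  rw [IsSymm, transpose_nonsing_inv, transpose_add, (lapMat_isSymm G).eq, transpose_one]

/-- A potential for a unit current from `i` to `j` computes the resistance between `i` and `j`
from any `{1}`-inverse of a symmetric matrix. -/
lemma resistance_eq_potential_sub {V : Type} [Fintype V] [DecidableEq V] {L X : Matrix V V ℝ}
    (hL : L.IsSymm) (hX : L * X * L = L) {w : V → ℝ} {i j : V}
    (hw : L *ᵥ w = Pi.single i 1 - Pi.single j 1) :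
    X i i + X j j - X i j - X j i = w i - w j := by
  have hw' : w ᵥ* L = Pi.single i 1 - Pi.single j 1 := by
    rw [← mulVec_transpose, hL.eq, hw]
  have h : w ⬝ᵥ ((L * X * L) *ᵥ w) = w ⬝ᵥ (L *ᵥ w) := by rw [hX]
  rw [← mulVec_mulVec, ← mulVec_mulVec, dotProduct_mulVec, hw', hw] at h
  simp only [mulVec_sub, mulVec_single_one, sub_dotProduct, dotProduct_sub,
    single_one_dotProduct, dotProduct_single_one, col_apply] at h
  linarith

/-- The potential on `K_{1,s} ∘₁ (G ∨ K₁)`, grounded at `u*`, with currents `b`. -/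
noncomputable def starJoinPotential {s n : ℕ} (G : SimpleGraph (Fin n)) (b : SCV s n → ℝ) :
    SCV s n → ℝ :=
  Sum.elim 0 (Sum.elim (fun i => b (Sum.inr (Sum.inl i)))
    ((lapMat G + (1 : Matrix (Fin n) (Fin n) ℝ))⁻¹ *ᵥ fun i => b (Sum.inr (Sum.inr i))))

lemma lapMat_mulVec_starJoinPotential {s n : ℕ} (G : SimpleGraph (Fin n)) (b : SCV s n → ℝ)
    (hb : ∑ v, b v = 0) :
    lapMat (StarJoinCoal s G) *ᵥ starJoinPotential G b = b := by
  classical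
  have hr : ∀ v, (lapMat (StarJoinCoal s G) *ᵥ starJoinPotential G b) (Sum.inr v)
      = b (Sum.inr v) := by
    rintro (i | i)
    · rw [lapMat_mulVec_apply]
      simp [StarJoinCoal, starJoinPotential]
    · set y := (lapMat G + (1 : Matrix (Fin n) (Fin n) ℝ))⁻¹ *ᵥ
        fun i => b (Sum.inr (Sum.inr i)) with hy
      have h : (lapMat G + 1) *ᵥ y = fun i => b (Sum.inr (Sum.inr i)) := by
        rw [hy, mulVec_mulVec, mul_nonsing_inv _
          ((isUnit_iff_isUnit_det _).1 (isUnit_lapMat_add_one G)), one_mulVec]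
      have hi := congrFun h i
      rw [add_mulVec, one_mulVec, Pi.add_apply, lapMat_mulVec_apply] at hi
      have hadj : ∀ j, G.Adj i j ↔ i ≠ j ∧ (G.Adj i j ∨ G.Adj j i) := fun j =>
        ⟨fun h => ⟨h.ne, Or.inl h⟩, fun h => h.2.elim id fun h => h.symm⟩
      rw [lapMat_mulVec_apply, ← hi]
      simp [StarJoinCoal, starJoinPotential, ← hy, ← hadj, add_comm]
  have hs := sum_lapMat_mulVec (StarJoinCoal s G) (starJoinPotential G b)
  rw [Fintype.sum_sum_type] at hs hb
  simp only [hr, Finset.univ_unique, Finset.sum_singleton] at hs hb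
  ext v
  rcases v with ⟨⟩ | v
  · exact add_right_cancel (hs.trans hb.symm)
  · exact hr v

/-- Resistance distances in `K_{1,p−1} ∘₁ (G ∨ K₁)` for a graph `G` on `n ≥ 1`
vertices and `p ≥ 1`: the matrix `L(G) + Iₙ` is invertible and the five case
formulas for the resistance distance hold. -/
theorem resistance_starJoinCoal (n p : ℕ) (hn : 1 ≤ n) (hp : 1 ≤ p)
    (G : SimpleGraph (Fin n)) :
    IsUnit (lapMat G + (1 : Matrix (Fin n) (Fin n) ℝ)) ∧
    ∀ X : Matrix (SCV (p - 1) n) (SCV (p - 1) n) ℝ,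
      lapMat (StarJoinCoal (p - 1) G) * X * lapMat (StarJoinCoal (p - 1) G)
        = lapMat (StarJoinCoal (p - 1) G) →
      -- (i) u* and a leaf
      (∀ j : Fin (p - 1),
        X (Sum.inl ()) (Sum.inl ()) + X (Sum.inr (Sum.inl j)) (Sum.inr (Sum.inl j))
          - X (Sum.inl ()) (Sum.inr (Sum.inl j)) - X (Sum.inr (Sum.inl j)) (Sum.inl ())
          = 1) ∧
      -- (ii) u* and a vertex of G
      (∀ j : Fin n,
        X (Sum.inl ()) (Sum.inl ()) + X (Sum.inr (Sum.inr j)) (Sum.inr (Sum.inr j))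
          - X (Sum.inl ()) (Sum.inr (Sum.inr j)) - X (Sum.inr (Sum.inr j)) (Sum.inl ())
          = (lapMat G + (1 : Matrix (Fin n) (Fin n) ℝ))⁻¹ j j) ∧
      -- (iii) two distinct leaves
      (∀ i j : Fin (p - 1), i ≠ j →
        X (Sum.inr (Sum.inl i)) (Sum.inr (Sum.inl i))
          + X (Sum.inr (Sum.inl j)) (Sum.inr (Sum.inl j))
          - X (Sum.inr (Sum.inl i)) (Sum.inr (Sum.inl j))
          - X (Sum.inr (Sum.inl j)) (Sum.inr (Sum.inl i)) = 2) ∧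
      -- (iv) a leaf and a vertex of G
      (∀ (i : Fin (p - 1)) (j : Fin n),
        X (Sum.inr (Sum.inl i)) (Sum.inr (Sum.inl i))
          + X (Sum.inr (Sum.inr j)) (Sum.inr (Sum.inr j))
          - X (Sum.inr (Sum.inl i)) (Sum.inr (Sum.inr j))
          - X (Sum.inr (Sum.inr j)) (Sum.inr (Sum.inl i))
          = 1 + (lapMat G + (1 : Matrix (Fin n) (Fin n) ℝ))⁻¹ j j) ∧
      -- (v) two distinct vertices of G
      (∀ i j : Fin n, i ≠ j →
        X (Sum.inr (Sum.inr i)) (Sum.inr (Sum.inr i))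
          + X (Sum.inr (Sum.inr j)) (Sum.inr (Sum.inr j))
          - X (Sum.inr (Sum.inr i)) (Sum.inr (Sum.inr j))
          - X (Sum.inr (Sum.inr j)) (Sum.inr (Sum.inr i))
          = (lapMat G + (1 : Matrix (Fin n) (Fin n) ℝ))⁻¹ i i
            + (lapMat G + (1 : Matrix (Fin n) (Fin n) ℝ))⁻¹ j j
            - 2 * (lapMat G + (1 : Matrix (Fin n) (Fin n) ℝ))⁻¹ i j) := by
  have hM := inv_lapMat_add_one_isSymm G
  refine ⟨isUnit_lapMat_add_one G, fun X hX => ?_⟩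
  have key : ∀ u v, X u u + X v v - X u v - X v u
      = starJoinPotential G (Pi.single u 1 - Pi.single v 1) u
        - starJoinPotential G (Pi.single u 1 - Pi.single v 1) v := fun u v =>
    resistance_eq_potential_sub (lapMat_isSymm _) hX
      (lapMat_mulVec_starJoinPotential G _ (by simp))
  refine ⟨fun j => ?_, fun j => ?_, fun i j hij => ?_, fun i j => ?_, fun i j _ => ?_⟩
  · rw [key]
    simp [starJoinPotential]
  · rw [key]
    simp [starJoinPotential, mulVec, dotProduct, Pi.single_apply]
  · rw [key]
    simp [starJoinPotential, hij, hij.symm]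
    norm_num
  · rw [key]
    simp [starJoinPotential, mulVec, dotProduct, Pi.single_apply]
  · rw [key]
    simp [starJoinPotential, mulVec, dotProduct, Pi.single_apply, mul_sub]
    linarith [hM.apply i j]
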